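/- Let q be real with 0 < |q| < 1. The linear map Δ_α defined on finitely supported vectors of ℓ²(ℕ×ℕ×ℤ) by Δ_α e(r,s,t) = c₁(r,s,t) e(r+1,s,t) + c₂(r,s,t) e(r,s−1,t), where c₁(r,s,t) = q^{2s+|t|+1} [g(r+t₋+1)g(r+t₊+1)/(g(r+s+|t|+1)g(r+s+|t|+2)) − 1], c₂(r,s,t) = g(s)g(s+|t|) [1/(g(r+s+|t|)g(r+s+|t|+1)) − 1] for s ≥ 1 and c₂(r,0,t) = 0, and e(r,−1,t) := 0, extends to a compact operator on ℓ²(ℕ×ℕ×ℤ). Equivalently, U λ_q(α_q) U* − (I⊗π_q(α_q)) − D_α is compact, where D_α e(r,s,t) = q^{2s+|t|+1} e(r+1,s,t) + g(s)(g(s+|t|)−1) e(r,s−1,t). -/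

import Mathlib

noncomputable section

/-- The lattice Γ = {(n,i,j) : 2n ∈ ℕ, i,j ∈ {−n,…,n}}, in the integer coordinates
(m,a,b) = (2n, n+i, n+j): Γ = {(m,a,b) ∈ ℕ³ : a ≤ m ∧ b ≤ m}. -/
abbrev GammaIdx : Type := {x : ℕ × ℕ × ℕ // x.2.1 ≤ x.1 ∧ x.2.2 ≤ x.1}

/-- ℓ²(Γ) -/
abbrev l2G : Type := lp (fun _ : GammaIdx => ℂ) 2

/-- ℓ²(ℕ×ℕ×ℤ) -/
abbrev l2Z3 : Type := lp (fun _ : ℕ × ℕ × ℤ => ℂ) 2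

/-- The canonical orthonormal basis vector e^n_{i,j} of ℓ²(Γ), in coordinates
(m,a,b) = (2n, n+i, n+j); by convention it is 0 when (m,a,b) ∉ Γ. -/
def eG (m a b : ℕ) : l2G :=
  if h : a ≤ m ∧ b ≤ m then lp.single 2 (⟨(m, a, b), h⟩ : GammaIdx) 1 else 0

/-- The canonical orthonormal basis vector e(r,s,t) of ℓ²(ℕ×ℕ×ℤ); by convention
it is 0 when r < 0 or s < 0. -/
def eZ (r s t : ℤ) : l2Z3 :=
  if 0 ≤ r ∧ 0 ≤ s then lp.single 2 (r.toNat, s.toNat, t) 1 else 0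

/-- The canonical orthonormal basis vector e(r,s,t) of ℓ²(ℕ×ℕ×ℤ). -/
def e3 (r s : ℕ) (t : ℤ) : l2Z3 := lp.single 2 (r, s, t) 1

/-- g(k) = (1 − q^{2k})^{1/2}  (so g(0) = 0). -/
def gq (q : ℝ) (k : ℕ) : ℝ := Real.sqrt (1 - q ^ (2 * k))

/-- The defining property of the unitary U : ℓ²(Γ) → ℓ²(ℕ×ℕ×ℤ):
U e^n_{i,j} = (−1)^{max(i,j)−j} e(n−max(i,j), n+min(i,j), j−i), i.e.
U e(m,a,b) = (−1)^{max(a,b)−b} e(m−max(a,b), min(a,b), b−a). -/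
def IsU (U : l2G ≃ₗᵢ[ℂ] l2Z3) : Prop :=
  ∀ m a b : ℕ, a ≤ m → b ≤ m →
    U (eG m a b) = ((-1 : ℂ) ^ (max a b - b)) •
      eZ ((m : ℤ) - (max a b : ℤ)) (min a b) ((b : ℤ) - (a : ℤ))

/-- a₊(n,i,j) = q^{2n+i+j+1} g(n−j+1)g(n−i+1)/(g(2n+1)g(2n+2)), in coordinates
(m,a,b) = (2n, n+i, n+j): a₊ = q^{a+b+1} g(m−b+1)g(m−a+1)/(g(m+1)g(m+2)). -/
def aP (q : ℝ) (m a b : ℕ) : ℝ :=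
  q ^ (a + b + 1) * gq q (m - b + 1) * gq q (m - a + 1) / (gq q (m + 1) * gq q (m + 2))

/-- a₋(n,i,j) = g(n+j)g(n+i)/(g(2n)g(2n+1)), i.e. a₋ = g(b)g(a)/(g(m)g(m+1)) (for m ≥ 1). -/
def aM (q : ℝ) (m a b : ℕ) : ℝ :=
  gq q b * gq q a / (gq q m * gq q (m + 1))

/-- λ_q(α_q): in coordinates (m,a,b), e(m,a,b) ↦ a₊ e(m+1,a,b) + a₋ e(m−1,a−1,b−1),
the a₋ term being omitted when m = 0 (i.e. n = 0). -/
def IsLambdaAlpha (q : ℝ) (L : l2G →L[ℂ] l2G) : Prop :=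
  ∀ m a b : ℕ, a ≤ m → b ≤ m →
    L (eG m a b) = ((aP q m a b : ℝ) : ℂ) • eG (m + 1) a b +
      (if 1 ≤ m then ((aM q m a b : ℝ) : ℂ) • eG (m - 1) (a - 1) (b - 1) else 0)

/-- c₁(r,s,t) = q^{2s+|t|+1} [g(r+t₋+1)g(r+t₊+1)/(g(r+s+|t|+1)g(r+s+|t|+2)) − 1]. -/
def c1 (q : ℝ) (r s : ℕ) (t : ℤ) : ℝ :=
  q ^ (2 * s + t.natAbs + 1) *
    (gq q (r + (-t).toNat + 1) * gq q (r + t.toNat + 1) /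
      (gq q (r + s + t.natAbs + 1) * gq q (r + s + t.natAbs + 2)) - 1)

/-- c₂(r,s,t) = g(s)g(s+|t|) [1/(g(r+s+|t|)g(r+s+|t|+1)) − 1] for s ≥ 1, and
c₂(r,0,t) = 0. -/
def c2 (q : ℝ) (r s : ℕ) (t : ℤ) : ℝ :=
  if s = 0 then 0 else
    gq q s * gq q (s + t.natAbs) *
      (1 / (gq q (r + s + t.natAbs) * gq q (r + s + t.natAbs + 1)) - 1)

section DiagonalOperator

variable {ι : Type*}

/-- The diagonal operator on `ℓ²(ι)` with coefficients `c` bounded by `C`. -/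
def diagL2 (c : ι → ℂ) (C : ℝ) (hc : ∀ i, ‖c i‖ ≤ C) :
    lp (fun _ : ι => ℂ) 2 →L[ℂ] lp (fun _ : ι => ℂ) 2 :=
  have bound (x : lp (fun _ : ι => ℂ) 2) (i : ι) :
      ‖c i * x i‖ ≤ ‖(((C : ℂ) • x : lp (fun _ : ι => ℂ) 2) : ι → ℂ) i‖ := by
    rw [lp.coeFn_smul, Pi.smul_apply, norm_smul, norm_mul]
    gcongr
    exact (hc i).trans (by simpa using le_abs_self C)
  LinearMap.mkContinuous
    { toFun := fun x => ⟨fun i => c i * x i, (lp.memℓp ((C : ℂ) • x)).mono' (bound x)⟩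
      map_add' := fun x y => by ext i; exact mul_add _ _ _
      map_smul' := fun a x => by ext i; simp [mul_left_comm] }
    |C| fun x => by
      have h := lp.norm_mono (x := (⟨fun i => c i * x i,
        (lp.memℓp ((C : ℂ) • x)).mono' (bound x)⟩ : lp (fun _ : ι => ℂ) 2))
        (by norm_num) (bound x)
      rw [norm_smul] at h
      simpa using h

theorem diagL2_apply (c : ι → ℂ) (C : ℝ) (hc : ∀ i, ‖c i‖ ≤ C)
    (x : lp (fun _ : ι => ℂ) 2) (i : ι) : diagL2 c C hc x i = c i * x i := rfl

variable [DecidableEq ι]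

theorem diagL2_single (c : ι → ℂ) (C : ℝ) (hc : ∀ i, ‖c i‖ ≤ C) (i : ι) :
    diagL2 c C hc (lp.single 2 i 1) = c i • lp.single 2 i 1 := by
  ext j
  rw [diagL2_apply, lp.coeFn_smul, Pi.smul_apply, smul_eq_mul, lp.single_apply]
  by_cases h : j = i
  · rw [h]
  · simp [h]

/-- The truncation to a finite set of coordinates of a diagonal operator on `ℓ²(ι)`. -/
def diagTrunc (c : ι → ℂ) (s : Finset ι) :
    lp (fun _ : ι => ℂ) 2 →L[ℂ] lp (fun _ : ι => ℂ) 2 :=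
  ∑ i ∈ s, c i • (lp.singleContinuousLinearMap ℂ (fun _ : ι => ℂ) 2 i ∘L
    lp.evalCLM ℂ (fun _ : ι => ℂ) 2 i)

theorem diagTrunc_apply (c : ι → ℂ) (s : Finset ι) (x : lp (fun _ : ι => ℂ) 2) (j : ι) :
    diagTrunc c s x j = if j ∈ s then c j * x j else 0 := by
  have h (i : ι) : ((c i • (lp.singleContinuousLinearMap ℂ (fun _ : ι => ℂ) 2 i ∘L
      lp.evalCLM ℂ (fun _ : ι => ℂ) 2 i)) x : lp (fun _ : ι => ℂ) 2) j =
      if j = i then c i * x i else 0 := by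
    change c i * (lp.single 2 i (x i) : lp (fun _ : ι => ℂ) 2) j = _
    rw [lp.single_apply]
    by_cases hij : j = i
    · subst hij; simp
    · simp [hij]
  rw [diagTrunc, sum_apply, lp.coeFn_sum, Finset.sum_apply,
    Finset.sum_congr rfl fun i _ => h i, Finset.sum_ite_eq]

theorem isCompactOperator_diagTrunc (c : ι → ℂ) (s : Finset ι) :
    IsCompactOperator (diagTrunc c s) := by
  rw [diagTrunc]
  induction s using Finset.induction_on with
  | empty => simpa using isCompactOperator_zero
  | insert i s hi ih =>
    rw [Finset.sum_insert hi]
    refine IsCompactOperator.add (IsCompactOperator.smul ?_ (c i)) ih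
    exact (isCompactOperator_of_locallyCompactSpace_rng
      (lp.singleContinuousLinearMap ℂ (fun _ : ι => ℂ) 2 i)).comp_clm _

theorem isCompactOperator_diagL2 (c : ι → ℂ) (C : ℝ) (hc : ∀ i, ‖c i‖ ≤ C)
    (h0 : Filter.Tendsto c Filter.cofinite (nhds 0)) :
    IsCompactOperator (diagL2 c C hc) := by
  refine isCompactOperator_of_tendsto (l := Filter.atTop) (F := diagTrunc c) ?_
    (Filter.Eventually.of_forall (isCompactOperator_diagTrunc c))
  rw [Metric.tendsto_atTop]
  intro ε hε
  have hfin : {i | ¬ ‖c i‖ < ε / 2}.Finite := by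
    have := (Metric.tendsto_nhds.1 h0) (ε / 2) (half_pos hε)
    simpa only [dist_zero_right, Filter.eventually_cofinite] using this
  refine ⟨hfin.toFinset, fun s hs => ?_⟩
  rw [dist_eq_norm]
  refine lt_of_le_of_lt (ContinuousLinearMap.opNorm_le_bound _ (half_pos hε).le fun x => ?_)
    (half_lt_self hε)
  have hx : ‖(diagTrunc c s - diagL2 c C hc) x‖ ≤ ‖((ε / 2 : ℝ) : ℂ) • x‖ := by
    refine lp.norm_mono (by norm_num) fun j => ?_
    rw [sub_apply, lp.coeFn_sub, Pi.sub_apply, diagTrunc_apply, diagL2_apply,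
      lp.coeFn_smul, Pi.smul_apply, norm_smul, Complex.norm_real,
      Real.norm_of_nonneg (half_pos hε).le]
    split_ifs with hj
    · rw [sub_self, norm_zero]
      positivity
    · rw [zero_sub, norm_neg, norm_mul]
      have : ‖c j‖ < ε / 2 := by
        by_contra hcon
        exact hj (hs (hfin.mem_toFinset.2 hcon))
      gcongr
  rwa [norm_smul, Complex.norm_real, Real.norm_of_nonneg (half_pos hε).le] at hx

theorem orthonormal_single_comp {f : ι → ι} (hf : Function.Injective f) :
    Orthonormal ℂ fun i => (lp.single 2 (f i) 1 : lp (fun _ : ι => ℂ) 2) := by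
  rw [orthonormal_iff_ite]
  intro i j
  rw [lp.inner_single_left, lp.single_apply, Pi.single_apply]
  simp [hf.eq_iff]

/-- The isometry of `ℓ²(ι)` mapping basis vectors along an injective map. -/
def basisShift {f : ι → ι} (hf : Function.Injective f) :
    lp (fun _ : ι => ℂ) 2 →L[ℂ] lp (fun _ : ι => ℂ) 2 :=
  (orthonormal_single_comp hf).orthogonalFamily.linearIsometry.toContinuousLinearMap

theorem basisShift_single {f : ι → ι} (hf : Function.Injective f) (i : ι) :
    basisShift hf (lp.single 2 i 1) = lp.single 2 (f i) 1 := by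
  refine ((orthonormal_single_comp hf).orthogonalFamily.linearIsometry_apply_single
    (1 : ℂ)).trans ?_
  simp

theorem adjoint_basisShift_apply {f : ι → ι} (hf : Function.Injective f)
    (x : lp (fun _ : ι => ℂ) 2) (i : ι) :
    ContinuousLinearMap.adjoint (basisShift hf) x i = x (f i) := by
  have h := ContinuousLinearMap.adjoint_inner_right (basisShift hf) (lp.single 2 i 1) x
  rw [basisShift_single, lp.inner_single_left, lp.inner_single_left] at h
  simpa using h

theorem l2_clm_ext {F : Type*} [AddCommMonoid F] [Module ℂ F] [TopologicalSpace F] [T2Space F]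
    {S T : lp (fun _ : ι => ℂ) 2 →L[ℂ] F}
    (h : ∀ i, S (lp.single 2 i 1) = T (lp.single 2 i 1)) : S = T := by
  refine lp.ext_continuousLinearMap (by norm_num) fun i => ?_
  ext
  simpa using h i

end DiagonalOperator

theorem gq_zero (q : ℝ) : gq q 0 = 0 := by simp [gq]

theorem gq_nonneg (q : ℝ) (k : ℕ) : 0 ≤ gq q k := Real.sqrt_nonneg _

theorem gq_le_one (q : ℝ) (k : ℕ) : gq q k ≤ 1 := by
  rw [gq, Real.sqrt_le_one, pow_mul]
  linarith [pow_nonneg (sq_nonneg q) k]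

theorem gq_pos {q : ℝ} (h1 : |q| < 1) {k : ℕ} (hk : k ≠ 0) : 0 < gq q k := by
  rw [gq, Real.sqrt_pos, pow_mul, sub_pos]
  exact pow_lt_one₀ (sq_nonneg q) ((sq_lt_one_iff_abs_lt_one q).2 h1) hk

theorem gq_mono {q : ℝ} (h1 : |q| < 1) {k l : ℕ} (h : k ≤ l) : gq q k ≤ gq q l := by
  rw [gq, gq, pow_mul, pow_mul]
  refine Real.sqrt_le_sqrt (sub_le_sub_left ?_ 1)
  exact pow_le_pow_of_le_one (sq_nonneg q) ((sq_lt_one_iff_abs_lt_one q).2 h1).le h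

theorem one_sub_gq_le {q : ℝ} (h1 : |q| < 1) {k l : ℕ} (h : k ≤ l) :
    1 - gq q l ≤ |q| ^ (2 * k) := by
  refine (sub_le_sub_left (gq_mono h1 h) 1).trans ?_
  have hg : gq q k ^ 2 = 1 - |q| ^ (2 * k) := by
    rw [gq, Real.sq_sqrt, pow_mul, pow_mul, sq_abs]
    rw [pow_mul, sub_nonneg]
    exact pow_le_one₀ (sq_nonneg q) ((sq_lt_one_iff_abs_lt_one q).2 h1).le
  nlinarith [gq_nonneg q k, gq_le_one q k]

theorem one_sub_gq_mul_gq_le {q : ℝ} (h1 : |q| < 1) {k a b : ℕ} (ha : k ≤ a) (hb : k ≤ b) :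
    1 - gq q a * gq q b ≤ 2 * |q| ^ (2 * k) := by
  nlinarith [one_sub_gq_le h1 ha, one_sub_gq_le h1 hb, gq_le_one q a, gq_le_one q b]

theorem gq_mul_gq_le_one (q : ℝ) (a b : ℕ) : gq q a * gq q b ≤ 1 :=
  mul_le_one₀ (gq_le_one q a) (gq_nonneg q b) (gq_le_one q b)

theorem gq_one_sq_le {q : ℝ} (h1 : |q| < 1) {a b : ℕ} (ha : a ≠ 0) (hb : b ≠ 0) :
    gq q 1 ^ 2 ≤ gq q a * gq q b := by
  rw [sq]
  exact mul_le_mul (gq_mono h1 (Nat.one_le_iff_ne_zero.2 ha))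
    (gq_mono h1 (Nat.one_le_iff_ne_zero.2 hb)) (gq_nonneg q 1) (gq_nonneg q a)

theorem abs_c1_le {q : ℝ} (h1 : |q| < 1) (r s : ℕ) (t : ℤ) :
    |c1 q r s t| ≤ 2 / gq q 1 ^ 2 * |q| ^ (r + s + t.natAbs) := by
  set x := gq q (r + (-t).toNat + 1) * gq q (r + t.toNat + 1) with hx
  set y := gq q (r + s + t.natAbs + 1) * gq q (r + s + t.natAbs + 2) with hy
  have hγ : 0 < gq q 1 ^ 2 := pow_pos (gq_pos h1 one_ne_zero) 2
  have hy0 : gq q 1 ^ 2 ≤ y := gq_one_sq_le h1 (by omega) (by omega)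
  have hx1 : x ≤ 1 := gq_mul_gq_le_one _ _ _
  have hy1 : y ≤ 1 := gq_mul_gq_le_one _ _ _
  have hx2 : 1 - x ≤ 2 * |q| ^ (2 * r) := one_sub_gq_mul_gq_le h1 (by omega) (by omega)
  have hy2 : 1 - y ≤ 2 * |q| ^ (2 * r) := one_sub_gq_mul_gq_le h1 (by omega) (by omega)
  have hxy : |x / y - 1| ≤ 2 * |q| ^ (2 * r) / gq q 1 ^ 2 := by
    have hyp : 0 < y := hγ.trans_le hy0
    rw [div_sub_one hyp.ne', abs_div, abs_of_pos hyp]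
    refine div_le_div₀ (by positivity) ?_ hγ hy0
    rw [abs_le]
    constructor <;> linarith
  have hc : c1 q r s t = q ^ (2 * s + t.natAbs + 1) * (x / y - 1) := rfl
  rw [hc, abs_mul, abs_pow]
  calc |q| ^ (2 * s + t.natAbs + 1) * |x / y - 1|
      ≤ |q| ^ (2 * s + t.natAbs + 1) * (2 * |q| ^ (2 * r) / gq q 1 ^ 2) := by gcongr
    _ = 2 / gq q 1 ^ 2 * |q| ^ (2 * s + t.natAbs + 1 + 2 * r) := by rw [pow_add _ _ (2 * r)]; ring
    _ ≤ 2 / gq q 1 ^ 2 * |q| ^ (r + s + t.natAbs) := by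
      gcongr ?_ * ?_
      exact pow_le_pow_of_le_one (abs_nonneg q) h1.le (by omega)

theorem abs_c2_le {q : ℝ} (h1 : |q| < 1) (r s : ℕ) (t : ℤ) :
    |c2 q r s t| ≤ 2 / gq q 1 ^ 2 * |q| ^ (r + s + t.natAbs) := by
  have hγ : 0 < gq q 1 ^ 2 := pow_pos (gq_pos h1 one_ne_zero) 2
  rw [c2]
  split_ifs with hs
  · rw [abs_zero]
    positivity
  set y := gq q (r + s + t.natAbs) * gq q (r + s + t.natAbs + 1) with hy
  have hy0 : gq q 1 ^ 2 ≤ y := gq_one_sq_le h1 (by omega) (by omega)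
  have hy1 : y ≤ 1 := gq_mul_gq_le_one _ _ _
  have hy2 : 1 - y ≤ 2 * |q| ^ (2 * (r + s + t.natAbs)) :=
    one_sub_gq_mul_gq_le h1 (by omega) (by omega)
  have hyp : 0 < y := hγ.trans_le hy0
  rw [abs_mul, abs_of_nonneg (mul_nonneg (gq_nonneg _ _) (gq_nonneg _ _)), div_sub_one hyp.ne',
    abs_div, abs_of_pos hyp, abs_of_nonneg (sub_nonneg.2 hy1)]
  calc gq q s * gq q (s + t.natAbs) * ((1 - y) / y)
      ≤ 1 * ((1 - y) / y) := by
        refine mul_le_mul_of_nonneg_right (gq_mul_gq_le_one _ _ _) ?_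
        exact div_nonneg (sub_nonneg.2 hy1) hyp.le
    _ ≤ 2 * |q| ^ (2 * (r + s + t.natAbs)) / gq q 1 ^ 2 := by
        rw [one_mul]
        exact div_le_div₀ (by positivity) hy2 hγ hy0
    _ = 2 / gq q 1 ^ 2 * |q| ^ (2 * (r + s + t.natAbs)) := by ring
    _ ≤ 2 / gq q 1 ^ 2 * |q| ^ (r + s + t.natAbs) := by
      gcongr ?_ * ?_
      exact pow_le_pow_of_le_one (abs_nonneg q) h1.le (by omega)

theorem tendsto_index_sum_cofinite :
    Filter.Tendsto (fun i : ℕ × ℕ × ℤ => i.1 + i.2.1 + i.2.2.natAbs)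
      Filter.cofinite Filter.atTop := by
  rw [Filter.tendsto_atTop]
  intro N
  rw [Filter.eventually_cofinite]
  refine ((Set.finite_Iic N).prod ((Set.finite_Iic N).prod
    (Set.finite_Icc (-(N : ℤ)) N))).subset ?_
  rintro ⟨r, s, t⟩ h
  simp only [Set.mem_ofPred_eq, Set.mem_prod, Set.mem_Iic, Set.mem_Icc] at h ⊢
  omega

/-- A weight on `ℕ × ℕ × ℤ` with geometric decay defines a compact diagonal operator. -/
theorem exists_compact_diagonal {q K : ℝ} (h1 : |q| < 1) (c : ℕ → ℕ → ℤ → ℝ)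
    (hK : 0 ≤ K) (hc : ∀ r s t, |c r s t| ≤ K * |q| ^ (r + s + t.natAbs)) :
    ∃ T : l2Z3 →L[ℂ] l2Z3, (∀ r s t, T (e3 r s t) = ((c r s t : ℝ) : ℂ) • e3 r s t) ∧
      IsCompactOperator T := by
  have hle (i : ℕ × ℕ × ℤ) : ‖((c i.1 i.2.1 i.2.2 : ℝ) : ℂ)‖ ≤
      K * |q| ^ (i.1 + i.2.1 + i.2.2.natAbs) := by
    rw [Complex.norm_real]
    exact hc _ _ _
  have hlim : Filter.Tendsto (fun i : ℕ × ℕ × ℤ => K * |q| ^ (i.1 + i.2.1 + i.2.2.natAbs))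
      Filter.cofinite (nhds 0) := by
    simpa using ((tendsto_pow_atTop_nhds_zero_of_lt_one (abs_nonneg q) h1).comp
      tendsto_index_sum_cofinite).const_mul K
  refine ⟨diagL2 (fun i : ℕ × ℕ × ℤ => ((c i.1 i.2.1 i.2.2 : ℝ) : ℂ)) K fun i => ?_, ?_, ?_⟩
  · exact (hle i).trans (mul_le_of_le_one_right hK (pow_le_one₀ (abs_nonneg q) h1.le))
  · exact fun r s t => diagL2_single _ _ _ _
  · exact isCompactOperator_diagL2 _ _ _ (squeeze_zero_norm hle hlim)

theorem eZ_natCast (r s : ℕ) (t : ℤ) : eZ r s t = e3 r s t := by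
  simp [eZ, e3]

theorem exists_raise_r : ∃ S : l2Z3 →L[ℂ] l2Z3, ∀ r s t, S (e3 r s t) = e3 (r + 1) s t := by
  have hf : Function.Injective fun i : ℕ × ℕ × ℤ => (i.1 + 1, i.2) := by
    rintro ⟨r, i⟩ ⟨r', i'⟩ h
    simpa using h
  exact ⟨basisShift hf, fun r s t => basisShift_single hf (r, s, t)⟩

theorem exists_lower_s :
    ∃ S : l2Z3 →L[ℂ] l2Z3, ∀ (r s : ℕ) (t : ℤ), S (e3 r s t) = eZ r ((s : ℤ) - 1) t := by
  have hf : Function.Injective fun i : ℕ × ℕ × ℤ => (i.1, i.2.1 + 1, i.2.2) := by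
    rintro ⟨r, s, t⟩ ⟨r', s', t'⟩ h
    simpa using h
  refine ⟨ContinuousLinearMap.adjoint (basisShift hf), fun r s t => ?_⟩
  ext ⟨r', s', t'⟩
  rw [adjoint_basisShift_apply]
  rcases s with _ | s
  · simp [eZ, e3]
  · rw [show ((s + 1 : ℕ) : ℤ) - 1 = (s : ℤ) by push_cast; ring, eZ_natCast]
    simp [e3, Pi.single_apply]

theorem IsU.apply_eG {U : l2G ≃ₗᵢ[ℂ] l2Z3} (hU : IsU U) (r s : ℕ) (t : ℤ) :
    U (eG (r + s + t.natAbs) (s + (-t).toNat) (s + t.toNat)) =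
      (-1 : ℂ) ^ (-t).toNat • e3 r s t := by
  rw [hU _ _ _ (by omega) (by omega), ← eZ_natCast]
  congr 2 <;> omega

theorem IsU.symm_apply_e3 {U : l2G ≃ₗᵢ[ℂ] l2Z3} (hU : IsU U) (r s : ℕ) (t : ℤ) :
    U.symm (e3 r s t) =
      (-1 : ℂ) ^ (-t).toNat • eG (r + s + t.natAbs) (s + (-t).toNat) (s + t.toNat) := by
  rw [LinearIsometryEquiv.symm_apply_eq, map_smul, hU.apply_eG, smul_smul, ← mul_pow]
  simp

theorem aP_sub_eq_c1 (q : ℝ) (r s : ℕ) (t : ℤ) :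
    aP q (r + s + t.natAbs) (s + (-t).toNat) (s + t.toNat) - q ^ (2 * s + t.natAbs + 1) =
      c1 q r s t := by
  rw [aP, c1, show s + (-t).toNat + (s + t.toNat) + 1 = 2 * s + t.natAbs + 1 by omega,
    show r + s + t.natAbs - (s + t.toNat) + 1 = r + (-t).toNat + 1 by omega,
    show r + s + t.natAbs - (s + (-t).toNat) + 1 = r + t.toNat + 1 by omega]
  ring

theorem aM_sub_eq_c2 (q : ℝ) (r s : ℕ) (t : ℤ) (hs : s ≠ 0) :
    aM q (r + s + t.natAbs) (s + (-t).toNat) (s + t.toNat) - gq q s -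
      gq q s * (gq q (s + t.natAbs) - 1) = c2 q r s t := by
  have h : gq q (s + t.toNat) * gq q (s + (-t).toNat) = gq q s * gq q (s + t.natAbs) := by
    obtain ⟨n, rfl | rfl⟩ := t.eq_nat_or_neg
    · simp [mul_comm]
    · simp
  rw [aM, c2, if_neg hs, h]
  ring

theorem IsLambdaAlpha.conj_apply_e3 {q : ℝ} {U : l2G ≃ₗᵢ[ℂ] l2Z3} (hU : IsU U)
    {L : l2G →L[ℂ] l2G} (hL : IsLambdaAlpha q L) (r s : ℕ) (t : ℤ) :
    U (L (U.symm (e3 r s t))) =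
      ((aP q (r + s + t.natAbs) (s + (-t).toNat) (s + t.toNat) : ℝ) : ℂ) • e3 (r + 1) s t +
      ((aM q (r + s + t.natAbs) (s + (-t).toNat) (s + t.toNat) : ℝ) : ℂ) •
        eZ r ((s : ℤ) - 1) t := by
  have hsign : (-1 : ℂ) ^ (-t).toNat * (-1 : ℂ) ^ (-t).toNat = 1 := by
    rw [← mul_pow]
    simp
  have hraise := hU.apply_eG (r + 1) s t
  rw [show r + 1 + s + t.natAbs = r + s + t.natAbs + 1 by omega] at hraise
  rw [hU.symm_apply_e3, map_smul, hL _ _ _ (by omega) (by omega), map_smul, map_add, map_smul,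
    hraise, smul_add, smul_comm _ (_ : ℂ) (_ : l2Z3), smul_smul ((-1 : ℂ) ^ _), hsign, one_smul]
  congr 1
  rcases s with _ | s
  · have h : aM q (r + 0 + t.natAbs) (0 + (-t).toNat) (0 + t.toNat) = 0 := by
      obtain ⟨n, rfl | rfl⟩ := t.eq_nat_or_neg <;> simp [aM, gq_zero]
    rw [h]
    simp
  · have hlower := hU.apply_eG r s t
    rw [if_pos (by omega), map_smul,
      show r + (s + 1) + t.natAbs - 1 = r + s + t.natAbs by omega,
      show s + 1 + (-t).toNat - 1 = s + (-t).toNat by omega,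
      show s + 1 + t.toNat - 1 = s + t.toNat by omega, hlower,
      smul_comm _ (_ : ℂ) (_ : l2Z3), smul_smul ((-1 : ℂ) ^ _), hsign, one_smul,
      show ((s + 1 : ℕ) : ℤ) - 1 = (s : ℤ) by push_cast; ring, eZ_natCast]

/-- the map Δ_α : e(r,s,t) ↦ c₁(r,s,t) e(r+1,s,t) + c₂(r,s,t) e(r,s−1,t)
extends to a compact operator on ℓ²(ℕ×ℕ×ℤ); equivalently,
U λ_q(α_q) U* − (I⊗π_q(α_q)) − D_α is compact, where
(I⊗π_q(α_q)) e(r,s,t) = g(s) e(r,s−1,t) and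
D_α e(r,s,t) = q^{2s+|t|+1} e(r+1,s,t) + g(s)(g(s+|t|)−1) e(r,s−1,t). -/
theorem stmt17 (q : ℝ) (h0 : 0 < |q|) (h1 : |q| < 1) :
    (∃ D : l2Z3 →L[ℂ] l2Z3,
      (∀ (r s : ℕ) (t : ℤ),
        D (e3 r s t) = ((c1 q r s t : ℝ) : ℂ) • e3 (r + 1) s t +
          ((c2 q r s t : ℝ) : ℂ) • eZ (r : ℤ) ((s : ℤ) - 1) t) ∧
      IsCompactOperator (⇑D)) ∧
    (∀ (U : l2G ≃ₗᵢ[ℂ] l2Z3), IsU U →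
      ∀ (Lα : l2G →L[ℂ] l2G), IsLambdaAlpha q Lα →
      ∀ (Pα : l2Z3 →L[ℂ] l2Z3),
        (∀ (r s : ℕ) (t : ℤ),
          Pα (e3 r s t) = ((gq q s : ℝ) : ℂ) • eZ (r : ℤ) ((s : ℤ) - 1) t) →
      ∀ (Dα : l2Z3 →L[ℂ] l2Z3),
        (∀ (r s : ℕ) (t : ℤ),
          Dα (e3 r s t) = ((q ^ (2 * s + t.natAbs + 1) : ℝ) : ℂ) • e3 (r + 1) s t +
            ((gq q s * (gq q (s + t.natAbs) - 1) : ℝ) : ℂ) • eZ (r : ℤ) ((s : ℤ) - 1) t) →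
      IsCompactOperator (fun ξ : l2Z3 => U (Lα (U.symm ξ)) - Pα ξ - Dα ξ)) := by
  have hK : 0 ≤ 2 / gq q 1 ^ 2 := by positivity
  obtain ⟨T₁, hT₁, hT₁c⟩ := exists_compact_diagonal h1 (c1 q) hK (abs_c1_le h1)
  obtain ⟨T₂, hT₂, hT₂c⟩ := exists_compact_diagonal h1 (c2 q) hK (abs_c2_le h1)
  obtain ⟨S₁, hS₁⟩ := exists_raise_r
  obtain ⟨S₂, hS₂⟩ := exists_lower_s
  have hD (r s : ℕ) (t : ℤ) : (S₁ ∘L T₁ + S₂ ∘L T₂) (e3 r s t) =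
      ((c1 q r s t : ℝ) : ℂ) • e3 (r + 1) s t +
        ((c2 q r s t : ℝ) : ℂ) • eZ (r : ℤ) ((s : ℤ) - 1) t := by
    rw [add_apply, ContinuousLinearMap.comp_apply,
      ContinuousLinearMap.comp_apply, hT₁, hT₂, map_smul, map_smul, hS₁, hS₂]
  have hDc : IsCompactOperator (S₁ ∘L T₁ + S₂ ∘L T₂) := (hT₁c.clm_comp S₁).add (hT₂c.clm_comp S₂)
  refine ⟨⟨_, hD, hDc⟩, fun U hU L hL P hP D hDα => ?_⟩
  have key : (U.toContinuousLinearEquiv : l2G →L[ℂ] l2Z3) ∘L L ∘L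
      (U.symm.toContinuousLinearEquiv : l2Z3 →L[ℂ] l2G) - P - D = S₁ ∘L T₁ + S₂ ∘L T₂ := by
    refine l2_clm_ext fun ⟨r, s, t⟩ => ?_
    change U (L (U.symm (e3 r s t))) - P (e3 r s t) - D (e3 r s t) =
      (S₁ ∘L T₁ + S₂ ∘L T₂) (e3 r s t)
    rw [hL.conj_apply_e3 hU, hP, hDα, hD, ← aP_sub_eq_c1]
    rcases eq_or_ne s 0 with rfl | hs
    · simp [eZ, sub_smul]
    · rw [← aM_sub_eq_c2 q r s t hs]
      push_cast
      module
  rw [← key] at hDc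
  exact hDc
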